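/- arXiv:2010.05704 — 10 statements merged into one kernel-verified Lean document; each statement's English description precedes it below -/
import Mathlib

section
/- Let w ∈ F be nonzero with q(w) = 0 (a lightlike direction). Then: (i) ψ₀(t·w) = t·w − b₀ for every t ∈ ℝ; (ii) the plane U = span{w, b₀} is totally isotropic, i.e. ⟨x, y⟩ = 0 for all x, y ∈ U, so every ψ₀(t·w) lies in U (the image of the lightlike line is contained in a photon); (iii) a vector x ∈ U satisfies ⟨x, a₀⟩ = 0 if and only if x ∈ span{w}, so the photon ℙ(U) meets the light cone of [a₀] in the single point [w]. -/
/-- For a nonzero lightlike `w ∈ F`: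
(i) `ψ₀(t·w) = t·w − b₀` for all `t`;
(ii) the plane `U = span{w, b₀}` is totally isotropic and every `ψ₀(t·w)` lies in `U`
(the image of the lightlike line is contained in a photon);
(iii) `x ∈ U` satisfies `⟨x, a₀⟩ = 0` iff `x ∈ span{w}`, so the photon `ℙ(U)` meets the
light cone of `[a₀]` in the single point `[w]`. -/
theorem stmt_3 (E : Type*) [AddCommGroup E] [Module ℝ E]
    (B : E →ₗ[ℝ] E →ₗ[ℝ] ℝ) (hsymm : ∀ x y, B x y = B y x)
    (a₀ b₀ : E) (ha : B a₀ a₀ = 0) (hb : B b₀ b₀ = 0) (hab : B a₀ b₀ = 1)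
    (ψ₀ : E → E) (hψ : ∀ u, ψ₀ u = u - b₀ + ((1 / 2 : ℝ) * B u u) • a₀)
    (w : E) (hw₀ : w ≠ 0) (hw₁ : B w a₀ = 0) (hw₂ : B w b₀ = 0) (hwq : B w w = 0) :
    (∀ t : ℝ, ψ₀ (t • w) = t • w - b₀) ∧
    (∀ x ∈ Submodule.span ℝ ({w, b₀} : Set E), ∀ y ∈ Submodule.span ℝ ({w, b₀} : Set E),
      B x y = 0) ∧
    (∀ t : ℝ, ψ₀ (t • w) ∈ Submodule.span ℝ ({w, b₀} : Set E)) ∧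
    (∀ x ∈ Submodule.span ℝ ({w, b₀} : Set E),
      (B x a₀ = 0 ↔ x ∈ Submodule.span ℝ ({w} : Set E))) := by
  have hψw : ∀ t : ℝ, ψ₀ (t • w) = t • w - b₀ := fun t => by simp [hψ, hwq]
  have hbw : B b₀ w = 0 := by rw [hsymm, hw₂]
  have hba : B b₀ a₀ = 1 := by rw [hsymm, hab]
  refine ⟨hψw, fun x hx y hy => ?_, fun t => ?_, fun x hx => ?_⟩
  · obtain ⟨s, t, rfl⟩ := Submodule.mem_span_pair.1 hx
    obtain ⟨s', t', rfl⟩ := Submodule.mem_span_pair.1 hy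
    simp [hwq, hw₂, hbw, hb]
  · rw [hψw, Submodule.mem_span_pair]
    exact ⟨t, -1, by rw [neg_one_smul, sub_eq_add_neg]⟩
  · rw [Submodule.mem_span_singleton]
    constructor
    · obtain ⟨s, t, rfl⟩ := Submodule.mem_span_pair.1 hx
      intro h
      have ht : t = 0 := by simpa [hw₁, hba] using h
      exact ⟨s, by simp [ht]⟩
    · rintro ⟨s, rfl⟩
      simp [hw₁]
end

section
/- Let z₁, z₂, z₃, z₄ ∈ E be nonzero vectors with q(zᵢ) = 0 for all i, ⟨z₁,z₂⟩ = ⟨z₂,z₃⟩ = ⟨z₃,z₄⟩ = ⟨z₄,z₁⟩ = 0, ⟨z₁,z₃⟩ ≠ 0 and ⟨z₂,z₄⟩ ≠ 0 (the normalized vertices of a Barbot crown). Then z₁, z₂, z₃, z₄ are linearly independent, the four vectors z₁+z₃, z₁−z₃, z₂+z₄, z₂−z₄ are pairwise ⟨·,·⟩-orthogonal and span the same subspace span{z₁,z₂,z₃,z₄}, and q(z₁+z₃)·q(z₁−z₃) < 0 and q(z₂+z₄)·q(z₂−z₄) < 0; hence exactly two of these four orthogonal basis vectors have positive q and two have negative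 q, i.e. the restriction of the form to span{z₁,z₂,z₃,z₄} has signature (2,2). -/
/-- Over `ℝ`, sums and differences of the pairs `a, c` and `b, d` span the same subspace as
`a, b, c, d`. -/
theorem span_add_sub_pairs {E : Type*} [AddCommGroup E] [Module ℝ E] (a b c d : E) :
    Submodule.span ℝ ({a + c, a - c, b + d, b - d} : Set E) =
      Submodule.span ℝ ({a, b, c, d} : Set E) := by
  apply le_antisymm <;> rw [Submodule.span_le]
  · have ha : a ∈ Submodule.span ℝ ({a, b, c, d} : Set E) := Submodule.subset_span (by simp)
    have hb : b ∈ Submodule.span ℝ ({a, b, c, d} : Set E) := Submodule.subset_span (by simp)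
    have hc : c ∈ Submodule.span ℝ ({a, b, c, d} : Set E) := Submodule.subset_span (by simp)
    have hd : d ∈ Submodule.span ℝ ({a, b, c, d} : Set E) := Submodule.subset_span (by simp)
    rintro x (rfl | rfl | rfl | rfl)
    exacts [add_mem ha hc, sub_mem ha hc, add_mem hb hd, sub_mem hb hd]
  · set S := Submodule.span ℝ ({a + c, a - c, b + d, b - d} : Set E)
    have hac : a + c ∈ S := Submodule.subset_span (by simp)
    have hac' : a - c ∈ S := Submodule.subset_span (by simp)
    have hbd : b + d ∈ S := Submodule.subset_span (by simp)
    have hbd' : b - d ∈ S := Submodule.subset_span (by simp)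
    have left_mem {x y : E} (h : x + y ∈ S) (h' : x - y ∈ S) : x ∈ S := by
      convert S.smul_mem (1 / 2 : ℝ) (add_mem h h') using 1
      module
    have right_mem {x y : E} (h : x + y ∈ S) (h' : x - y ∈ S) : y ∈ S := by
      convert S.smul_mem (1 / 2 : ℝ) (sub_mem h h') using 1
      module
    rintro x (rfl | rfl | rfl | rfl)
    exacts [left_mem hac hac', left_mem hbd hbd', right_mem hac hac', right_mem hbd hbd']

/-- For isotropic `x, y`, the product of the values of the quadratic form at `x + y` and `x - y`
is `-4 (B x y) ^ 2`. -/
theorem apply_add_self_mul_apply_sub_self {E : Type*} [AddCommGroup E] [Module ℝ E]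
    (B : E →ₗ[ℝ] E →ₗ[ℝ] ℝ) (hsymm : ∀ x y, B x y = B y x) {x y : E}
    (hx : B x x = 0) (hy : B y y = 0) :
    B (x + y) (x + y) * B (x - y) (x - y) = -4 * B x y ^ 2 := by
  simp only [map_add, map_sub, LinearMap.add_apply, LinearMap.sub_apply, hx, hy, hsymm y x]
  ring

/-- The normalized vertices `z₁,z₂,z₃,z₄` of a Barbot crown (isotropic,
consecutively orthogonal, with `⟨z₁,z₃⟩ ≠ 0 ≠ ⟨z₂,z₄⟩`) are linearly independent; the
vectors `z₁+z₃, z₁−z₃, z₂+z₄, z₂−z₄` are pairwise orthogonal and span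
`span{z₁,z₂,z₃,z₄}`, and `q(z₁+z₃)·q(z₁−z₃) < 0`, `q(z₂+z₄)·q(z₂−z₄) < 0`: the span
has signature (2,2). -/
theorem stmt_6 (E : Type*) [AddCommGroup E] [Module ℝ E]
    (B : E →ₗ[ℝ] E →ₗ[ℝ] ℝ) (hsymm : ∀ x y, B x y = B y x)
    (z₁ z₂ z₃ z₄ : E)
    (h₁ : z₁ ≠ 0) (h₂ : z₂ ≠ 0) (h₃ : z₃ ≠ 0) (h₄ : z₄ ≠ 0)
    (hq₁ : B z₁ z₁ = 0) (hq₂ : B z₂ z₂ = 0) (hq₃ : B z₃ z₃ = 0) (hq₄ : B z₄ z₄ = 0)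
    (h₁₂ : B z₁ z₂ = 0) (h₂₃ : B z₂ z₃ = 0) (h₃₄ : B z₃ z₄ = 0) (h₄₁ : B z₄ z₁ = 0)
    (h₁₃ : B z₁ z₃ ≠ 0) (h₂₄ : B z₂ z₄ ≠ 0) :
    LinearIndependent ℝ ![z₁, z₂, z₃, z₄] ∧
    B (z₁ + z₃) (z₁ - z₃) = 0 ∧
    B (z₁ + z₃) (z₂ + z₄) = 0 ∧ B (z₁ + z₃) (z₂ - z₄) = 0 ∧
    B (z₁ - z₃) (z₂ + z₄) = 0 ∧ B (z₁ - z₃) (z₂ - z₄) = 0 ∧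
    B (z₂ + z₄) (z₂ - z₄) = 0 ∧
    Submodule.span ℝ ({z₁ + z₃, z₁ - z₃, z₂ + z₄, z₂ - z₄} : Set E) =
      Submodule.span ℝ ({z₁, z₂, z₃, z₄} : Set E) ∧
    B (z₁ + z₃) (z₁ + z₃) * B (z₁ - z₃) (z₁ - z₃) < 0 ∧
    B (z₂ + z₄) (z₂ + z₄) * B (z₂ - z₄) (z₂ - z₄) < 0 := by
  have h₂₁ := (hsymm z₂ z₁).trans h₁₂
  have h₃₂ := (hsymm z₃ z₂).trans h₂₃
  have h₄₃ := (hsymm z₄ z₃).trans h₃₄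
  have h₁₄ := (hsymm z₁ z₄).trans h₄₁
  have h₃₁ := hsymm z₃ z₁
  have h₄₂ := hsymm z₄ z₂
  refine ⟨?_, ?_, ?_, ?_, ?_, ?_, ?_, ?_, ?_, ?_⟩
  · rw [Fintype.linearIndependent_iff]
    intro g hg
    simp only [Fin.sum_univ_four, Matrix.cons_val] at hg
    have pairing (w : E) : B w (g 0 • z₁ + g 1 • z₂ + g 2 • z₃ + g 3 • z₄) = 0 := by
      rw [hg, map_zero]
    have e₁ := pairing z₁
    have e₂ := pairing z₂
    have e₃ := pairing z₃
    have e₄ := pairing z₄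
    simp only [map_add, map_smul, smul_eq_mul, hq₁, hq₂, hq₃, hq₄, h₁₂, h₂₁, h₂₃, h₃₂, h₃₄, h₄₃,
      h₄₁, h₁₄, h₃₁, h₄₂, mul_zero, add_zero, zero_add, mul_eq_zero, h₁₃, h₂₄, or_false]
      at e₁ e₂ e₃ e₄
    intro i
    fin_cases i <;> assumption
  · simp [*]
  · simp [*]
  · simp [*]
  · simp [*]
  · simp [*]
  · simp [*]
  · exact span_add_sub_pairs z₁ z₂ z₃ z₄
  · rw [apply_add_self_mul_apply_sub_self B hsymm hq₁ hq₃]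
    have := sq_pos_of_ne_zero h₁₃
    linarith
  · rw [apply_add_self_mul_apply_sub_self B hsymm hq₂ hq₄]
    have := sq_pos_of_ne_zero h₂₄
    linarith
end

section
/- For all u, v, w ∈ F with q(w − u) ≠ 0 and q(w − v) ≠ 0, one has (⟨a₀, ψ₀(u)⟩ · ⟨ψ₀(w), ψ₀(v)⟩) / (⟨a₀, ψ₀(v)⟩ · ⟨ψ₀(w), ψ₀(u)⟩) = q(w − v)/q(w − u). (This is the paper's formula expressing the cross-ratio b(a, x, b, y) of four boundary points in a Minkowski chart for a as q(b − y)/q(b − x), where x, b, y are the chart images of u, w, v.) -/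
/-- The pairing of a null vector `a` with a point of the Minkowski chart based at `(a, b)`. -/
lemma apply_null_minkowskiChart {E : Type*} [AddCommGroup E] [Module ℝ E]
    (B : E →ₗ[ℝ] E →ₗ[ℝ] ℝ) {a b x : E} (ha : B a a = 0) (hab : B a b = 1)
    (hx : B a x = 0) (r : ℝ) :
    B a (x - b + r • a) = -1 := by
  simp [ha, hab, hx]

/-- The pairing of two points of the Minkowski chart based at `(a, b)`. -/
lemma apply_minkowskiChart_minkowskiChart {E : Type*} [AddCommGroup E] [Module ℝ E]
    (B : E →ₗ[ℝ] E →ₗ[ℝ] ℝ) (hsymm : ∀ x y, B x y = B y x) {a b x y : E}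
    (ha : B a a = 0) (hb : B b b = 0) (hab : B a b = 1)
    (hxa : B x a = 0) (hxb : B x b = 0) (hya : B y a = 0) (hyb : B y b = 0) :
    B (x - b + ((1 / 2 : ℝ) * B x x) • a) (y - b + ((1 / 2 : ℝ) * B y y) • a) =
      -(1 / 2) * B (x - y) (x - y) := by
  have hba : B b a = 1 := by rw [hsymm, hab]
  have hay : B a y = 0 := by rw [hsymm, hya]
  have hby : B b y = 0 := by rw [hsymm, hyb]
  simp only [map_add, map_sub, map_smul, LinearMap.add_apply, LinearMap.sub_apply,
    LinearMap.smul_apply, smul_eq_mul, ha, hb, hab, hba, hxa, hxb, hay, hby, hsymm y x]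
  ring

/-- In the canonical Minkowski chart, for `u, v, w ∈ F` with
`q(w−u) ≠ 0 ≠ q(w−v)`, the cross-ratio of the boundary points `a, ψ₀(u), ψ₀(w), ψ₀(v)`
equals `q(w−v)/q(w−u)`:
`(⟨a₀,ψ₀(u)⟩·⟨ψ₀(w),ψ₀(v)⟩)/(⟨a₀,ψ₀(v)⟩·⟨ψ₀(w),ψ₀(u)⟩) = q(w−v)/q(w−u)`. -/
theorem stmt_7 (E : Type*) [AddCommGroup E] [Module ℝ E]
    (B : E →ₗ[ℝ] E →ₗ[ℝ] ℝ) (hsymm : ∀ x y, B x y = B y x)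
    (a₀ b₀ : E) (ha : B a₀ a₀ = 0) (hb : B b₀ b₀ = 0) (hab : B a₀ b₀ = 1)
    (ψ₀ : E → E) (hψ : ∀ u, ψ₀ u = u - b₀ + ((1 / 2 : ℝ) * B u u) • a₀)
    (u v w : E)
    (hu₁ : B u a₀ = 0) (hu₂ : B u b₀ = 0)
    (hv₁ : B v a₀ = 0) (hv₂ : B v b₀ = 0)
    (hw₁ : B w a₀ = 0) (hw₂ : B w b₀ = 0)
    (hwu : B (w - u) (w - u) ≠ 0) (hwv : B (w - v) (w - v) ≠ 0) :
    (B a₀ (ψ₀ u) * B (ψ₀ w) (ψ₀ v)) / (B a₀ (ψ₀ v) * B (ψ₀ w) (ψ₀ u)) =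
      B (w - v) (w - v) / B (w - u) (w - u) := by
  rw [hψ u, hψ v, hψ w,
    apply_null_minkowskiChart B ha hab (by rw [hsymm, hu₁]),
    apply_null_minkowskiChart B ha hab (by rw [hsymm, hv₁]),
    apply_minkowskiChart_minkowskiChart B hsymm ha hb hab hw₁ hw₂ hv₁ hv₂,
    apply_minkowskiChart_minkowskiChart B hsymm ha hb hab hw₁ hw₂ hu₁ hu₂]
  field_simp
end

section
/- Let b = (−1, 0) and c = (1, 0) in F, and let u, v, x ∈ F satisfy u − b ∈ C, c − v ∈ C, x − u ∈ C and v − x ∈ C (so u, x, v all lie in the diamond determined by b and c, and x lies in the sub-diamond determined by u and v). Then q(w − b) > 0 and q(c − w) > 0 for each w ∈ {u, x, v}, and q(c − v)/q(v − b) < q(c − x)/q(x − b) < q(c − u)/q(u − b). (This is the paper's corollary that the cross-ratio function w ↦ b(a, b, w, c) is strictly decreasing along the causal order on a diamond, expressed in a τ-chart.) -/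
/-- The Minkowski quadratic form `q(v) = v₁² − ‖v′‖²` on `F = ℝ × ℝⁿ`. -/
noncomputable def Mq (n : ℕ) (v : ℝ × EuclideanSpace ℝ (Fin n)) : ℝ :=
  v.1 ^ 2 - ‖v.2‖ ^ 2

/-- The open future cone `C = {v | ‖v′‖ < v₁}`. -/
def MC (n : ℕ) : Set (ℝ × EuclideanSpace ℝ (Fin n)) := {v | ‖v.2‖ < v.1}

section

variable {n : ℕ} {v w : ℝ × EuclideanSpace ℝ (Fin n)}

theorem add_mem_MC (hv : v ∈ MC n) (hw : w ∈ MC n) : v + w ∈ MC n :=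
  (norm_add_le v.2 w.2).trans_lt (add_lt_add hv hw)

theorem Mq_pos_of_mem_MC (hv : v ∈ MC n) : 0 < Mq n v :=
  sub_pos.2 (pow_lt_pow_left₀ hv (norm_nonneg _) two_ne_zero)

/-- The Minkowski form strictly increases on the future cone under future translations. -/
theorem Mq_lt_Mq_add (hv : v ∈ MC n) (hw : w ∈ MC n) : Mq n v < Mq n (v + w) := by
  have hv' : ‖v.2‖ < v.1 := hv
  have hw' : ‖w.2‖ < w.1 := hw
  have hsq : ‖v.2 + w.2‖ ^ 2 ≤ (‖v.2‖ + ‖w.2‖) ^ 2 :=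
    pow_le_pow_left₀ (norm_nonneg _) (norm_add_le _ _) 2
  have hmul : ‖v.2‖ * ‖w.2‖ ≤ v.1 * w.1 :=
    mul_le_mul hv'.le hw'.le (norm_nonneg _) ((norm_nonneg _).trans hv'.le)
  have hpos : 0 < w.1 ^ 2 - ‖w.2‖ ^ 2 := Mq_pos_of_mem_MC hw
  simp only [Mq, Prod.fst_add, Prod.snd_add]
  nlinarith

/-- The ratio of Minkowski forms to the two tips of a diamond strictly decreases along the
causal order. -/
theorem Mq_div_Mq_lt_of_sub_mem_MC {b c : ℝ × EuclideanSpace ℝ (Fin n)}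
    (hb : v - b ∈ MC n) (hvw : w - v ∈ MC n) (hc : c - w ∈ MC n) :
    Mq n (c - w) / Mq n (w - b) < Mq n (c - v) / Mq n (v - b) := by
  have h₁ := Mq_lt_Mq_add hc hvw
  have h₂ := Mq_lt_Mq_add hb hvw
  rw [sub_add_sub_cancel] at h₁
  rw [sub_add_sub_cancel'] at h₂
  exact div_lt_div₀ h₁ h₂.le ((Mq_pos_of_mem_MC hc).trans h₁).le (Mq_pos_of_mem_MC hb)

end

/-- With `b = (−1,0)`, `c = (1,0)`, if `u − b, c − v, x − u, v − x` all lie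
in the open future cone, then `q(w − b) > 0` and `q(c − w) > 0` for `w ∈ {u, x, v}`, and
`q(c−v)/q(v−b) < q(c−x)/q(x−b) < q(c−u)/q(u−b)`: the cross-ratio function is strictly
decreasing along the causal order on a diamond. -/
theorem stmt_8 (n : ℕ) (b c u v x : ℝ × EuclideanSpace ℝ (Fin n))
    (hb : b = (-1, 0)) (hc : c = (1, 0))
    (h1 : u - b ∈ MC n) (h2 : c - v ∈ MC n) (h3 : x - u ∈ MC n) (h4 : v - x ∈ MC n) :
    (0 < Mq n (u - b) ∧ 0 < Mq n (c - u)) ∧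
    (0 < Mq n (x - b) ∧ 0 < Mq n (c - x)) ∧
    (0 < Mq n (v - b) ∧ 0 < Mq n (c - v)) ∧
    Mq n (c - v) / Mq n (v - b) < Mq n (c - x) / Mq n (x - b) ∧
    Mq n (c - x) / Mq n (x - b) < Mq n (c - u) / Mq n (u - b) := by
  have hxb : x - b ∈ MC n := by simpa using add_mem_MC h3 h1
  have hvb : v - b ∈ MC n := by simpa using add_mem_MC h4 hxb
  have hcx : c - x ∈ MC n := by simpa using add_mem_MC h2 h4
  have hcu : c - u ∈ MC n := by simpa using add_mem_MC hcx h3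
  exact ⟨⟨Mq_pos_of_mem_MC h1, Mq_pos_of_mem_MC hcu⟩,
    ⟨Mq_pos_of_mem_MC hxb, Mq_pos_of_mem_MC hcx⟩,
    ⟨Mq_pos_of_mem_MC hvb, Mq_pos_of_mem_MC h2⟩,
    Mq_div_Mq_lt_of_sub_mem_MC hxb h4 h2, Mq_div_Mq_lt_of_sub_mem_MC h1 h3 hcx⟩
end

section
/- For all constants A, B, C > 1 there exists D > 1 with the following property. Let Ω be a dense subset of ℙ(V), and let ξ be a map from Ω to ℙ(E) such that for all distinct x, y ∈ Ω, representatives of ξ(x) and ξ(y) are non-orthogonal, and such that for every quadruple (x, y, z, t) of pairwise distinct points of Ω, A⁻¹ ≤ |[x,y,z,t]| ≤ A implies B⁻¹ ≤ |b_ξ(x,y,z,t)| ≤ B. Then for every quadruple (x, y, z, t) of pairwise distinct points of Ω, C⁻¹ ≤ |[x,y,z,t]| ≤ C implies D⁻¹ ≤ |b_ξ(x,y,z,t)| ≤ D. (That is, in the definition of an (A,B)-quasisymmetric map the choice of the constant A is irrelevant.) -/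
open scoped LinearAlgebra.Projectivization

/-- The quotient topology on the real projective line `ℙ(ℝ²)`. -/
instance : TopologicalSpace (Projectivization ℝ (ℝ × ℝ)) :=
  inferInstanceAs (TopologicalSpace (Quotient _))

/-- The determinant form `ω(v,w) = v₁w₂ − v₂w₁` on `V = ℝ²`. -/
def om (v w : ℝ × ℝ) : ℝ := v.1 * w.2 - v.2 * w.1

/-- The projective cross-ratio `[x,y,z,t]` on `ℙ(V)`, computed with representatives. -/
noncomputable def crV (x y z t : Projectivization ℝ (ℝ × ℝ)) : ℝ :=
  (om x.rep y.rep * om z.rep t.rep) / (om x.rep t.rep * om z.rep y.rep)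

/-- The cross-ratio `b(x,y,z,t)` on the projectivization of `E`, computed with
representatives via the bilinear form `Bil`. -/
noncomputable def crE {E : Type*} [AddCommGroup E] [Module ℝ E]
    (Bil : E →ₗ[ℝ] E →ₗ[ℝ] ℝ) (x y z t : Projectivization ℝ E) : ℝ :=
  (Bil x.rep y.rep * Bil z.rep t.rep) / (Bil x.rep t.rep * Bil z.rep y.rep)

lemma om_ne_zero_of_ne {x y : Projectivization ℝ (ℝ × ℝ)} (h : x ≠ y) :
    om x.rep y.rep ≠ 0 := by
  intro h0
  apply h
  rw [← x.mk_rep, ← y.mk_rep, Projectivization.mk_eq_mk_iff']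
  have hy := y.rep_nonzero
  generalize x.rep = v at *
  generalize y.rep = w at *
  obtain ⟨v1, v2⟩ := v
  obtain ⟨w1, w2⟩ := w
  simp only [om] at h0
  by_cases hw : w1 = 0
  · have hw2 : w2 ≠ 0 := fun h2 => hy (by simp [hw, h2])
    have hv : v1 = 0 := by simpa [hw, hw2] using h0
    exact ⟨v2 / w2, by simp [hw, hv, hw2]⟩
  · refine ⟨v1 / w1, ?_⟩
    ext
    · simp [hw]
    · simp only [Prod.smul_mk, smul_eq_mul]
      field_simp
      linarith

lemma om_self (v : ℝ × ℝ) : om v v = 0 := by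
  simp only [om]
  ring

lemma om_smul_right (a : ℝ) (v w : ℝ × ℝ) : om v (a • w) = a * om v w := by
  simp only [om, Prod.smul_fst, Prod.smul_snd, smul_eq_mul]
  ring

lemma continuous_om (v : ℝ × ℝ) : Continuous (om v) := by
  unfold om
  fun_prop

/-- The cross-ratio is multiplicative in its second and fourth arguments. -/
lemma crV_mul {x y z t s : Projectivization ℝ (ℝ × ℝ)} (hx : x ≠ s) (hz : z ≠ s) :
    crV x y z s * crV x s z t = crV x y z t := by
  have h1 := om_ne_zero_of_ne hx
  have h2 := om_ne_zero_of_ne hz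
  unfold crV
  rw [div_mul_div_comm, mul_comm (om x.rep s.rep * om z.rep y.rep)]
  rw [← mul_div_mul_right (om x.rep y.rep * om z.rep t.rep) _ (mul_ne_zero h1 h2)]
  congr 1 <;> ring

lemma crE_mul {E : Type*} [AddCommGroup E] [Module ℝ E] (Bil : E →ₗ[ℝ] E →ₗ[ℝ] ℝ)
    {x y z t s : Projectivization ℝ E} (hx : Bil x.rep s.rep ≠ 0) (hz : Bil z.rep s.rep ≠ 0) :
    crE Bil x y z s * crE Bil x s z t = crE Bil x y z t := by
  unfold crE
  rw [div_mul_div_comm, mul_comm (Bil x.rep s.rep * Bil z.rep y.rep)]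
  rw [← mul_div_mul_right (Bil x.rep y.rep * Bil z.rep t.rep) _ (mul_ne_zero hx hz)]
  congr 1 <;> ring

/-- A continuous absolutely homogeneous strict inequality defines an open subset of `ℙ(V)`. -/
lemma isOpen_setOf_rep_lt {f g : ℝ × ℝ → ℝ} (hf : Continuous f) (hg : Continuous g)
    (hf' : ∀ (a : ℝ) v, f (a • v) = |a| * f v) (hg' : ∀ (a : ℝ) v, g (a • v) = |a| * g v) :
    IsOpen {s : Projectivization ℝ (ℝ × ℝ) | f s.rep < g s.rep} ∧
      ∀ v (hv : v ≠ 0), f v < g v →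
        f (Projectivization.mk ℝ v hv).rep < g (Projectivization.mk ℝ v hv).rep := by
  have key : ∀ v (hv : v ≠ 0),
      f (Projectivization.mk ℝ v hv).rep < g (Projectivization.mk ℝ v hv).rep ↔ f v < g v := by
    intro v hv
    obtain ⟨a, ha⟩ := Projectivization.exists_smul_eq_mk_rep ℝ v hv
    rw [← ha, Units.smul_def, hf', hg']
    exact mul_lt_mul_iff_right₀ (abs_pos.mpr a.ne_zero)
  refine ⟨?_, fun v hv => (key v hv).mpr⟩
  refine isOpen_coinduced.mpr ?_
  have : IsOpen {v : {v : ℝ × ℝ // v ≠ 0} | f v < g v} :=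
    isOpen_lt (hf.comp continuous_subtype_val) (hg.comp continuous_subtype_val)
  convert this using 1
  ext v
  exact key v.1 v.2

/-- As `s` ranges over a dense set, `|[x,y,z,s]|` meets every open interval of positive reals. -/
lemma exists_mem_crV_mem_Ioo {Ω : Set (Projectivization ℝ (ℝ × ℝ))} (hΩ : Dense Ω)
    {x y z : Projectivization ℝ (ℝ × ℝ)} (hxy : x ≠ y) (hxz : x ≠ z) (hyz : y ≠ z)
    {lo hi : ℝ} (hlo : 0 < lo) (hlh : lo < hi) :
    ∃ s ∈ Ω, x ≠ s ∧ z ≠ s ∧ lo < |crV x y z s| ∧ |crV x y z s| < hi := by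
  set p := om x.rep y.rep with hp
  set q := om z.rep y.rep with hq
  have hp0 : 0 < |p| := abs_pos.mpr (om_ne_zero_of_ne hxy)
  have hq0 : 0 < |q| := abs_pos.mpr (om_ne_zero_of_ne hyz.symm)
  have hxz0 := om_ne_zero_of_ne hxz
  have cont (c : ℝ) (v : ℝ × ℝ) : Continuous fun w => c * |om v w| :=
    continuous_const.mul (continuous_om v).abs
  have hom (c : ℝ) (v : ℝ × ℝ) (a : ℝ) (w : ℝ × ℝ) :
      c * |om v (a • w)| = |a| * (c * |om v w|) := by
    rw [om_smul_right, abs_mul]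
    ring
  obtain ⟨o1, m1⟩ := isOpen_setOf_rep_lt (cont (lo * |q|) x.rep) (cont |p| z.rep)
    (hom _ _) (hom _ _)
  obtain ⟨o2, m2⟩ := isOpen_setOf_rep_lt (cont |p| z.rep) (cont (hi * |q|) x.rep)
    (hom _ _) (hom _ _)
  obtain ⟨m, hm1, hm2⟩ := exists_between hlh
  have hm0 : 0 < m := hlo.trans hm1
  set v : ℝ × ℝ := (m * |q|) • x.rep + |p| • z.rep with hv
  have hxv : om x.rep v = |p| * om x.rep z.rep := by
    simp only [hv, om, Prod.fst_add, Prod.snd_add, Prod.smul_fst, Prod.smul_snd, smul_eq_mul]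
    ring
  have hzv : om z.rep v = -(m * |q| * om x.rep z.rep) := by
    simp only [hv, om, Prod.fst_add, Prod.snd_add, Prod.smul_fst, Prod.smul_snd, smul_eq_mul]
    ring
  have hv0 : v ≠ 0 := by
    intro h
    rw [h] at hxv
    have : om x.rep 0 = 0 := by simp [om]
    rw [this] at hxv
    exact mul_ne_zero hp0.ne' hxz0 hxv.symm
  have axv : |om x.rep v| = |p| * |om x.rep z.rep| := by rw [hxv, abs_mul, abs_abs]
  have azv : |om z.rep v| = m * |q| * |om x.rep z.rep| := by
    rw [hzv, abs_neg, abs_mul, abs_mul, abs_abs, abs_of_pos hm0]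
  have hpos : 0 < |p| * |q| * |om x.rep z.rep| :=
    mul_pos (mul_pos hp0 hq0) (abs_pos.mpr hxz0)
  obtain ⟨s, ⟨hs1, hs2⟩, hs⟩ := hΩ.inter_open_nonempty _ (o1.inter o2)
    ⟨Projectivization.mk ℝ v hv0, m1 v hv0 (by rw [axv, azv]; nlinarith),
      m2 v hv0 (by rw [axv, azv]; nlinarith)⟩
  simp only [Set.mem_ofPred_eq] at hs1 hs2
  have hzs : z ≠ s := by
    rintro rfl
    rw [om_self, abs_zero, mul_zero] at hs1
    exact hs1.not_ge (by positivity)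
  have hxs : x ≠ s := by
    rintro rfl
    rw [om_self, abs_zero, mul_zero] at hs2
    exact hs2.not_ge (by positivity)
  have hxs0 : 0 < |om x.rep s.rep| := abs_pos.mpr (om_ne_zero_of_ne hxs)
  refine ⟨s, hs, hxs, hzs, ?_, ?_⟩
  · rw [crV, abs_div, abs_mul, abs_mul, lt_div_iff₀ (mul_pos hxs0 hq0)]
    linarith
  · rw [crV, abs_div, abs_mul, abs_mul, div_lt_iff₀ (mul_pos hxs0 hq0)]
    linarith

lemma crV_self {x y z : Projectivization ℝ (ℝ × ℝ)} (hxy : x ≠ y) (hzy : z ≠ y) :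
    crV x y z y = 1 := by
  have h1 := om_ne_zero_of_ne hxy
  have h2 := om_ne_zero_of_ne hzy
  unfold crV
  exact div_self (mul_ne_zero h1 h2)

/-- A quasisymmetry bound for cross-ratios in `[(a²)⁻¹, a²]` self-improves to larger
cross-ratios by inserting intermediate points. -/
lemma crE_bound_of_crV_le_pow {E : Type*} [AddCommGroup E] [Module ℝ E]
    (Bil : E →ₗ[ℝ] E →ₗ[ℝ] ℝ) {a B : ℝ} (ha : 1 < a) (hB : 1 < B)
    {Ω : Set (Projectivization ℝ (ℝ × ℝ))}
    {ξ : Projectivization ℝ (ℝ × ℝ) → Projectivization ℝ E} (hΩ : Dense Ω)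
    (hξ : ∀ x ∈ Ω, ∀ y ∈ Ω, x ≠ y → Bil (ξ x).rep (ξ y).rep ≠ 0)
    {x z : Projectivization ℝ (ℝ × ℝ)} (hx : x ∈ Ω) (hz : z ∈ Ω) (hxz : x ≠ z)
    (H : ∀ y ∈ Ω, ∀ t ∈ Ω, x ≠ y → x ≠ t → y ≠ z → y ≠ t → z ≠ t →
      (a ^ 2)⁻¹ ≤ |crV x y z t| → |crV x y z t| ≤ a ^ 2 →
      B⁻¹ ≤ |crE Bil (ξ x) (ξ y) (ξ z) (ξ t)| ∧ |crE Bil (ξ x) (ξ y) (ξ z) (ξ t)| ≤ B)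
    (n : ℕ) :
    ∀ y ∈ Ω, ∀ t ∈ Ω, x ≠ y → x ≠ t → y ≠ z → y ≠ t → z ≠ t →
      (a ^ (n + 2))⁻¹ ≤ |crV x y z t| → |crV x y z t| ≤ a ^ (n + 2) →
      (B ^ (n + 1))⁻¹ ≤ |crE Bil (ξ x) (ξ y) (ξ z) (ξ t)| ∧
        |crE Bil (ξ x) (ξ y) (ξ z) (ξ t)| ≤ B ^ (n + 1) := by
  have ha0 : 0 < a := one_pos.trans ha
  have hB0 : 0 < B := one_pos.trans hB
  induction n with
  | zero => simpa using H
  | succ n ih =>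
    intro y hy t ht hxy hxt hyz hyt hzt h1 h2
    have split : ∀ s ∈ Ω, x ≠ s → z ≠ s → y ≠ s → s ≠ t →
        (a ^ 2)⁻¹ ≤ |crV x y z s| → |crV x y z s| ≤ a ^ 2 →
        (a ^ (n + 2))⁻¹ ≤ |crV x s z t| → |crV x s z t| ≤ a ^ (n + 2) →
        (B ^ (n + 1 + 1))⁻¹ ≤ |crE Bil (ξ x) (ξ y) (ξ z) (ξ t)| ∧
          |crE Bil (ξ x) (ξ y) (ξ z) (ξ t)| ≤ B ^ (n + 1 + 1) := by
      intro s hs hxs hzs hys hst e1 e2 e3 e4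
      obtain ⟨p1, p2⟩ := H y hy s hs hxy hxs hyz hys hzs e1 e2
      obtain ⟨q1, q2⟩ := ih s hs t ht hxs hxt hzs.symm hst hzt e3 e4
      rw [← crE_mul Bil (hξ x hx s hs hxs) (hξ z hz s hs hzs), abs_mul,
        pow_succ' B (n + 1), mul_inv]
      exact ⟨by gcongr, by gcongr⟩
    have hmono : a ^ 2 ≤ a ^ (n + 2) := pow_le_pow_right₀ ha.le (by omega)
    have hlt : a < a ^ 2 := by nlinarith
    have hpow : a ^ (n + 1 + 2) = a * a ^ (n + 2) := by ring
    rw [hpow] at h1 h2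
    rcases lt_or_ge (a ^ 2) |crV x y z t| with hr | hr
    · obtain ⟨s, hs, hxs, hzs, l, u⟩ := exists_mem_crV_mem_Ioo hΩ hxy hxz hyz ha0 hlt
      have hmul := congrArg abs (crV_mul (y := y) (t := t) hxs hzs)
      rw [abs_mul] at hmul
      refine split s hs hxs hzs ?_ ?_ ?_ u.le ?_ ?_
      · rintro rfl
        rw [crV_self hxy hyz.symm, abs_one] at l
        linarith
      · rintro rfl
        linarith
      · exact (inv_le_one_of_one_le₀ (by nlinarith)).trans (ha.trans l).le
      · refine (inv_le_one_of_one_le₀ (by nlinarith)).trans ?_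
        by_contra! hc
        nlinarith [abs_nonneg (crV x y z s)]
      · by_contra! hc
        nlinarith [mul_lt_mul'' l hc ha0.le (by positivity)]
    rcases lt_or_ge |crV x y z t| (a ^ 2)⁻¹ with hr' | hr'
    · have hinv : (a ^ 2)⁻¹ < a⁻¹ := inv_strictAnti₀ ha0 hlt
      have hinv1 : a⁻¹ < 1 := inv_lt_one_of_one_lt₀ ha
      obtain ⟨s, hs, hxs, hzs, l, u⟩ :=
        exists_mem_crV_mem_Ioo hΩ hxy hxz hyz (inv_pos.mpr (pow_pos ha0 2)) hinv
      have hmul := congrArg abs (crV_mul (y := y) (t := t) hxs hzs)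
      rw [abs_mul] at hmul
      refine split s hs hxs hzs ?_ ?_ l.le ?_ ?_ ?_
      · rintro rfl
        rw [crV_self hxy hyz.symm, abs_one] at u
        linarith
      · rintro rfl
        linarith
      · exact (u.trans hinv1).le.trans (by nlinarith)
      · by_contra! hc
        rw [mul_inv] at h1
        have := mul_lt_mul'' u hc (abs_nonneg _) (abs_nonneg _)
        linarith
      · refine le_trans ?_ (show (1 : ℝ) ≤ a ^ (n + 2) by nlinarith)
        by_contra! hc
        nlinarith [abs_nonneg (crV x y z s)]
    obtain ⟨p1, p2⟩ := H y hy t ht hxy hxt hyz hyt hzt hr' hr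
    have hBpow : B ≤ B ^ (n + 1 + 1) := le_self_pow₀ hB.le (by omega)
    exact ⟨(inv_anti₀ hB0 hBpow).trans p1, p2.trans hBpow⟩

/-- In the definition of an `(A,B)`-quasisymmetric map the choice of the
constant `A` is irrelevant: for all `A, B, C > 1` there is `D > 1` such that any map `ξ`
on a dense subset `Ω` of `ℙ(V)`, with pairwise non-orthogonal values, satisfying the
`(A,B)` cross-ratio implication on quadruples of `Ω`, also satisfies the `(C,D)` one. -/
theorem stmt_9 {E : Type*} [AddCommGroup E] [Module ℝ E]
    (Bil : E →ₗ[ℝ] E →ₗ[ℝ] ℝ) (hsymm : ∀ x y, Bil x y = Bil y x)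
    (A B C : ℝ) (hA : 1 < A) (hB : 1 < B) (hC : 1 < C) :
    ∃ D : ℝ, 1 < D ∧
      ∀ (Ω : Set (Projectivization ℝ (ℝ × ℝ)))
        (ξ : Projectivization ℝ (ℝ × ℝ) → Projectivization ℝ E),
        Dense Ω →
        (∀ x ∈ Ω, ∀ y ∈ Ω, x ≠ y → Bil (ξ x).rep (ξ y).rep ≠ 0) →
        (∀ x ∈ Ω, ∀ y ∈ Ω, ∀ z ∈ Ω, ∀ t ∈ Ω,
          x ≠ y → x ≠ z → x ≠ t → y ≠ z → y ≠ t → z ≠ t →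
          A⁻¹ ≤ |crV x y z t| → |crV x y z t| ≤ A →
          B⁻¹ ≤ |crE Bil (ξ x) (ξ y) (ξ z) (ξ t)| ∧
            |crE Bil (ξ x) (ξ y) (ξ z) (ξ t)| ≤ B) →
        ∀ x ∈ Ω, ∀ y ∈ Ω, ∀ z ∈ Ω, ∀ t ∈ Ω,
          x ≠ y → x ≠ z → x ≠ t → y ≠ z → y ≠ t → z ≠ t →
          C⁻¹ ≤ |crV x y z t| → |crV x y z t| ≤ C →
          D⁻¹ ≤ |crE Bil (ξ x) (ξ y) (ξ z) (ξ t)| ∧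
            |crE Bil (ξ x) (ξ y) (ξ z) (ξ t)| ≤ D := by
  have ha : 1 < √A := Real.lt_sqrt_of_sq_lt (by simpa using hA)
  have hsq : √A ^ 2 = A := Real.sq_sqrt (by linarith)
  obtain ⟨n, hn⟩ := pow_unbounded_of_one_lt C ha
  have hCn : C ≤ √A ^ (n + 2) := hn.le.trans (pow_le_pow_right₀ ha.le (by omega))
  refine ⟨B ^ (n + 1), one_lt_pow₀ hB (by omega), ?_⟩
  intro Ω ξ hΩ hξ H x hx y hy z hz t ht hxy hxz hxt hyz hyt hzt h1 h2
  refine crE_bound_of_crV_le_pow Bil ha hB hΩ hξ hx hz hxz ?_ n y hy t ht hxy hxt hyz hyt hzt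
    ((inv_anti₀ (by linarith) hCn).trans h1) (h2.trans hCn)
  rw [hsq]
  intro y hy t ht hxy hxt hyz hyt hzt
  exact H x hx y hy z hz t ht hxy hxz hxt hyz hyt hzt
end

section
/- Let O ⊆ ℝ be a nonempty open interval, let Ω ⊆ O be dense in O, and let f : ℝ → F be semi-positive on Ω, meaning that f(y) − f(x) ∈ J for all x, y ∈ Ω with x ≤ y. Then for every x ∈ O the one-sided limits of f along Ω exist: there exist L⁺, L⁻ ∈ F such that f(y) → L⁺ as y → x with y ∈ Ω, y > x, and f(y) → L⁻ as y → x with y ∈ Ω, y < x. -/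
/-- The closed future cone `J = {v | ‖v′‖ ≤ v₁}` in `F = ℝ × ℝⁿ`. -/
def MJ (n : ℕ) : Set (ℝ × EuclideanSpace ℝ (Fin n)) := {v | ‖v.2‖ ≤ v.1}

/-- If the variation of `f` on `s` is controlled by that of a real function `g`, then `f`
converges along every filter containing `s` along which `g` converges. -/
theorem exists_tendsto_of_dist_le {α E : Type*} [PseudoMetricSpace E] [CompleteSpace E] [Nonempty E]
    {l : Filter α} {s : Set α} (hs : s ∈ l) {f : α → E} {g : α → ℝ}
    (hfg : ∀ x ∈ s, ∀ y ∈ s, dist (f x) (f y) ≤ dist (g x) (g y))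
    {c : ℝ} (hg : Filter.Tendsto g l (nhds c)) : ∃ L, Filter.Tendsto f l (nhds L) := by
  rcases l.eq_or_neBot with rfl | hl
  · exact ⟨Classical.arbitrary E, Filter.tendsto_bot⟩
  have hgc := (cauchy_map_iff.1 hg.cauchy_map).2
  have hfc : Cauchy (Filter.map f l) := by
    refine cauchy_map_iff.2 ⟨hl, ?_⟩
    rw [tendsto_uniformity_iff_dist_tendsto_zero] at hgc ⊢
    refine squeeze_zero' (Filter.Eventually.of_forall fun _ => dist_nonneg) ?_ hgc
    filter_upwards [Filter.prod_mem_prod hs hs] with p hp using hfg _ hp.1 _ hp.2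
  exact CompleteSpace.complete hfc

theorem dist_le_dist_fst_of_sub_mem_MJ {n : ℕ} {u v : ℝ × EuclideanSpace ℝ (Fin n)}
    (h : v - u ∈ MJ n) : dist u v ≤ dist u.1 v.1 := by
  have h' : ‖v.2 - u.2‖ ≤ v.1 - u.1 := h
  rw [Prod.dist_eq, max_le_iff, dist_comm u.2, dist_comm u.1, dist_eq_norm v.2, Real.dist_eq]
  exact ⟨le_rfl, h'.trans (le_abs_self _)⟩

/-- Between two points of `s`, a real function monotone on `s` agrees on `s` with a monotone
function on the whole line. -/
theorem MonotoneOn.exists_monotone_eqOn_Icc {s : Set ℝ} {g : ℝ → ℝ} (hg : MonotoneOn g s)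
    {c d : ℝ} (hc : c ∈ s) (hd : d ∈ s) :
    ∃ G : ℝ → ℝ, Monotone G ∧ Set.EqOn g G (s ∩ Set.Icc c d) := by
  refine (hg.mono Set.inter_subset_left).exists_monotone_extension ⟨g c, ?_⟩ ⟨g d, ?_⟩
  · rintro _ ⟨y, ⟨hy, hcy, -⟩, rfl⟩
    exact hg hc hy hcy
  · rintro _ ⟨y, ⟨hy, -, hyd⟩, rfl⟩
    exact hg hy hd hyd

/-- Let `O = (a,b)` be a nonempty open interval, `Ω ⊆ O` dense in `O`, and
`f` semi-positive on `Ω` (i.e. `f(y) − f(x) ∈ J` for `x ≤ y` in `Ω`).  Then for every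
`x ∈ O` the one-sided limits of `f` along `Ω` exist. -/
theorem stmt_11 (n : ℕ) (a b : ℝ) (hab : a < b) (Ω : Set ℝ)
    (hΩ₁ : Ω ⊆ Set.Ioo a b) (hΩ₂ : Set.Ioo a b ⊆ closure Ω)
    (f : ℝ → ℝ × EuclideanSpace ℝ (Fin n))
    (hf : ∀ x ∈ Ω, ∀ y ∈ Ω, x ≤ y → f y - f x ∈ MJ n) :
    ∀ x ∈ Set.Ioo a b,
      (∃ Lp : ℝ × EuclideanSpace ℝ (Fin n),
        Filter.Tendsto f (nhdsWithin x (Ω ∩ Set.Ioi x)) (nhds Lp)) ∧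
      (∃ Lm : ℝ × EuclideanSpace ℝ (Fin n),
        Filter.Tendsto f (nhdsWithin x (Ω ∩ Set.Iio x)) (nhds Lm)) := by
  intro x hx
  have hdense : ∀ u v, a ≤ u → v ≤ b → u < v → ∃ y ∈ Ω, y ∈ Set.Ioo u v := by
    intro u v hu hv huv
    obtain ⟨m, hm⟩ := exists_between huv
    obtain ⟨y, hy, hyΩ⟩ := mem_closure_iff.1 (hΩ₂ ⟨hu.trans_lt hm.1, hm.2.trans_le hv⟩)
      (Set.Ioo u v) isOpen_Ioo hm
    exact ⟨y, hyΩ, hy⟩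
  obtain ⟨c, hc, -, hcx⟩ := hdense a x le_rfl hx.2.le hx.1
  obtain ⟨d, hd, hxd, -⟩ := hdense x b hx.1.le le_rfl hx.2
  have hmono : MonotoneOn (fun y => (f y).1) Ω := fun y hy z hz hyz =>
    sub_nonneg.1 ((norm_nonneg ((f z).2 - (f y).2)).trans (hf y hy z hz hyz))
  have hdist : ∀ y ∈ Ω, ∀ z ∈ Ω, dist (f y) (f z) ≤ dist (f y).1 (f z).1 := by
    intro y hy z hz
    rcases le_total y z with h | h
    · exact dist_le_dist_fst_of_sub_mem_MJ (hf y hy z hz h)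
    · rw [dist_comm, dist_comm (f y).1]
      exact dist_le_dist_fst_of_sub_mem_MJ (hf z hz y hy h)
  obtain ⟨G, hG, hfG⟩ := hmono.exists_monotone_eqOn_Icc hc hd
  have hlim : ∀ t : Set ℝ, ∀ r : ℝ, Filter.Tendsto G (nhdsWithin x t) (nhds r) →
      ∃ L, Filter.Tendsto f (nhdsWithin x (Ω ∩ t)) (nhds L) := by
    intro t r hr
    have hΩ : Ω ∈ nhdsWithin x (Ω ∩ t) :=
      Filter.mem_of_superset self_mem_nhdsWithin Set.inter_subset_left
    refine exists_tendsto_of_dist_le hΩ hdist (c := r) ?_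
    refine (hr.mono_left (nhdsWithin_mono x Set.inter_subset_right)).congr' ?_
    filter_upwards [hΩ, mem_nhdsWithin_of_mem_nhds (Icc_mem_nhds hcx hxd)] with y hy hy'
    exact (hfG ⟨hy, hy'⟩).symm
  exact ⟨hlim _ _ (hG.tendsto_nhdsGT x), hlim _ _ (hG.tendsto_nhdsLT x)⟩
end

section
/- Let A, B > 1, let O ⊆ ℝ be a nonempty open interval and let Ω ⊆ O be dense in O. Let f : Ω → F be positive and (A,B)-quasisymmetric on Ω. Then f extends uniquely to a continuous map g : O → F, and this extension g is positive and (A,B)-quasisymmetric on O. -/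
/-- `f` is positive on `Ω`: `f(y) − f(x)` lies in the open future cone for `x < y` in `Ω`. -/
def MPos (n : ℕ) (f : ℝ → ℝ × EuclideanSpace ℝ (Fin n)) (Ω : Set ℝ) : Prop :=
  ∀ x ∈ Ω, ∀ y ∈ Ω, x < y → f y - f x ∈ MC n

/-- `f` is `(A,B)`-quasisymmetric on `Ω`: positive, and for pairwise distinct
`x, y, z ∈ Ω`, `A⁻¹ ≤ |x−y|/|z−x| ≤ A` implies `B⁻¹ ≤ q(f x − f y)/q(f z − f x) ≤ B`. -/
noncomputable def MQS (n : ℕ) (A B : ℝ) (f : ℝ → ℝ × EuclideanSpace ℝ (Fin n))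
    (Ω : Set ℝ) : Prop :=
  MPos n f Ω ∧
  ∀ x ∈ Ω, ∀ y ∈ Ω, ∀ z ∈ Ω, x ≠ y → y ≠ z → x ≠ z →
    (A⁻¹ ≤ |x - y| / |z - x| ∧ |x - y| / |z - x| ≤ A) →
    (B⁻¹ ≤ Mq n (f x - f y) / Mq n (f z - f x) ∧
      Mq n (f x - f y) / Mq n (f z - f x) ≤ B)

open Filter Topology Set

/-- The future cone absorbs vectors of the closed future cone. -/
lemma MC_add_causal {n : ℕ} {v w : ℝ × EuclideanSpace ℝ (Fin n)} (hv : v ∈ MC n)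
    (hw : ‖w.2‖ ≤ w.1) : v + w ∈ MC n := by
  have h := norm_add_le v.2 w.2
  simp only [MC, mem_ofPred_eq, Prod.fst_add, Prod.snd_add] at hv ⊢
  linarith

lemma Mq_pos {n : ℕ} {v : ℝ × EuclideanSpace ℝ (Fin n)} (hv : v ∈ MC n) : 0 < Mq n v := by
  simp only [MC, mem_ofPred_eq] at hv
  have := norm_nonneg v.2
  simp only [Mq]
  nlinarith

lemma Mq_sub_comm (n : ℕ) (v w : ℝ × EuclideanSpace ℝ (Fin n)) :
    Mq n (v - w) = Mq n (w - v) := by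
  simp only [Mq, Prod.fst_sub, Prod.snd_sub, norm_sub_rev v.2 w.2]
  ring

lemma continuous_Mq (n : ℕ) : Continuous (Mq n) := by
  unfold Mq
  fun_prop

lemma MPos.Mq_sub_pos {n : ℕ} {f : ℝ → ℝ × EuclideanSpace ℝ (Fin n)} {s : Set ℝ}
    (hf : MPos n f s) {x y : ℝ} (hx : x ∈ s) (hy : y ∈ s) (hxy : x ≠ y) :
    0 < Mq n (f x - f y) := by
  rcases hxy.lt_or_gt with h | h
  · rw [Mq_sub_comm]
    exact Mq_pos (hf x hx y hy h)
  · exact Mq_pos (hf y hy x hx h)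

/-- A bound on the quadratic form of `d + v` by that of `v` controls the time component of `d`
by that of `v`. -/
lemma fst_le_of_Mq_add_le {n : ℕ} {B : ℝ} (hB : 0 < B) {d v : ℝ × EuclideanSpace ℝ (Fin n)}
    (hd : d ∈ MC n) (hv : v ∈ MC n) (h : Mq n (d + v) ≤ B * Mq n v) : d.1 ≤ B * v.1 := by
  have hn := norm_add_le d.2 v.2
  have hd0 := norm_nonneg d.2
  have hv0 := norm_nonneg v.2
  have hs0 := norm_nonneg (d.2 + v.2)
  simp only [MC, mem_ofPred_eq] at hd hv
  simp only [Mq, Prod.fst_add, Prod.snd_add] at h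
  generalize ‖d.2 + v.2‖ = r at *
  generalize ‖d.2‖ = p at *
  generalize ‖v.2‖ = q at *
  generalize d.1 = s at *
  generalize v.1 = t at *
  have hr : r ^ 2 ≤ (p + q) ^ 2 := by gcongr
  have hlow : 2 * s * (t - q) ≤ (s + t) ^ 2 - r ^ 2 := by nlinarith
  have hup : B * (t ^ 2 - q ^ 2) ≤ 2 * (B * t) * (t - q) := by
    have : t ^ 2 - q ^ 2 ≤ 2 * t * (t - q) := by nlinarith
    nlinarith
  have hfin : s * (t - q) ≤ B * t * (t - q) := by linarith
  exact le_of_mul_le_mul_right hfin (by linarith)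

lemma MQS.fst_sub_le {n : ℕ} {A B : ℝ} (hA : 1 < A) (hB : 1 < B)
    {f : ℝ → ℝ × EuclideanSpace ℝ (Fin n)} {Ω : Set ℝ} (hf : MQS n A B f Ω)
    {x y z : ℝ} (hx : x ∈ Ω) (hy : y ∈ Ω) (hz : z ∈ Ω) (hxy : x < y) (hyz : y < z)
    (h : z - x ≤ A * (y - x)) : (f z).1 - (f y).1 ≤ B * ((f y).1 - (f x).1) := by
  have hxz := hxy.trans hyz
  have hzx : 0 < z - x := sub_pos.2 hxz
  have hratio := (hf.2 x hx y hy z hz hxy.ne hyz.ne hxz.ne (by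
    rw [abs_sub_comm x y, abs_of_pos (sub_pos.2 hxy), abs_of_pos hzx]
    constructor
    · rw [le_div_iff₀ hzx, inv_mul_le_iff₀ (by linarith)]
      exact h
    · rw [div_le_iff₀ hzx]
      nlinarith)).1
  have hq := hf.1.Mq_sub_pos hz hx hxz.ne'
  rw [le_div_iff₀ hq, inv_mul_le_iff₀ (by linarith), Mq_sub_comm n (f x)] at hratio
  have := fst_le_of_Mq_add_le (zero_lt_one.trans hB) (hf.1 y hy z hz hyz) (hf.1 x hx y hy hxy)
    (by rwa [sub_add_sub_cancel])
  simpa using this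

lemma MPos.fst_lt {n : ℕ} {f : ℝ → ℝ × EuclideanSpace ℝ (Fin n)} {Ω : Set ℝ}
    (hf : MPos n f Ω) {x y : ℝ} (hx : x ∈ Ω) (hy : y ∈ Ω) (hxy : x < y) :
    (f x).1 < (f y).1 := by
  have h : ‖(f y - f x).2‖ < (f y - f x).1 := hf x hx y hy hxy
  have h0 := norm_nonneg (f y - f x).2
  simp only [Prod.fst_sub] at h
  linarith

lemma MPos.dist_le {n : ℕ} {f : ℝ → ℝ × EuclideanSpace ℝ (Fin n)} {Ω : Set ℝ}
    (hf : MPos n f Ω) {x y : ℝ} (hx : x ∈ Ω) (hy : y ∈ Ω) :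
    dist (f x) (f y) ≤ |(f x).1 - (f y).1| := by
  wlog hxy : x ≤ y generalizing x y
  · rw [dist_comm, abs_sub_comm]
    exact this hy hx (le_of_not_ge hxy)
  rcases hxy.eq_or_lt with rfl | hlt
  · simp
  have h : ‖(f y - f x).2‖ < (f y - f x).1 := hf x hx y hy hlt
  rw [dist_comm, dist_eq_norm, Prod.norm_def, abs_sub_comm]
  exact max_le (by simp) (h.le.trans (le_abs_self _))

lemma exists_mem_of_subset_closure {a b u v : ℝ} {Ω : Set ℝ} (hΩ : Ioo a b ⊆ closure Ω)
    (hau : a ≤ u) (huv : u < v) (hvb : v ≤ b) : ∃ s ∈ Ω, u < s ∧ s < v := by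
  obtain ⟨m, hum, hmv⟩ := exists_between huv
  obtain ⟨s, hs, hsΩ⟩ := mem_closure_iff.1 (hΩ ⟨hau.trans_lt hum, hmv.trans_le hvb⟩)
    (Ioo u v) isOpen_Ioo ⟨hum, hmv⟩
  exact ⟨s, hsΩ, hs⟩

/-- Near each point of the interval, the time component of `f` oscillates arbitrarily little. -/
lemma MQS.exists_fst_sub_lt {n : ℕ} {A B : ℝ} (hA : 1 < A) (hB : 1 < B) {a b : ℝ} {Ω : Set ℝ}
    (hΩ : Ioo a b ⊆ closure Ω) {f : ℝ → ℝ × EuclideanSpace ℝ (Fin n)} (hf : MQS n A B f Ω)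
    {x : ℝ} (hx : x ∈ Ioo a b) {ε : ℝ} (hε : 0 < ε) :
    ∃ y ∈ Ω, ∃ z ∈ Ω, y < x ∧ x < z ∧ (f z).1 - (f y).1 < ε := by
  obtain ⟨w, hw, hxw, -⟩ := exists_mem_of_subset_closure hΩ hx.1.le hx.2 le_rfl
  obtain ⟨w₀, hw₀, -, hw₀x⟩ := exists_mem_of_subset_closure hΩ le_rfl hx.1 hx.2.le
  set T : Set ℝ := (fun s ↦ (f s).1) '' (Ω ∩ Iio x)
  have hTne : T.Nonempty := ⟨_, w₀, ⟨hw₀, hw₀x⟩, rfl⟩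
  have hTbdd : BddAbove T := by
    refine ⟨(f w).1, ?_⟩
    rintro _ ⟨s, ⟨hs, hsx⟩, rfl⟩
    exact (hf.1.fst_lt hs hw (lt_trans hsx hxw)).le
  have hB0 : 0 < B := by linarith
  obtain ⟨_, ⟨u, ⟨hu, hux⟩, rfl⟩, hut⟩ :=
    exists_lt_of_lt_csSup hTne (sub_lt_self (sSup T) (div_pos hε hB0))
  simp only [mem_Iio] at hux
  have hA0 : 0 < A := by linarith
  have hlt : u + (x - u) / A < x := by
    have := div_lt_self (sub_pos.2 hux) hA
    linarith
  obtain ⟨y, hy, hy₁, hyx⟩ := exists_mem_of_subset_closure hΩ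
    (le_max_left a (u + (x - u) / A)) (max_lt hx.1 hlt) hx.2.le
  have hy₁ := (le_max_right _ _).trans_lt hy₁
  have huy : u < y := by
    have := div_pos (sub_pos.2 hux) hA0
    linarith
  have hxA : x < u + A * (y - u) := by
    have : (x - u) / A < y - u := by linarith
    rw [div_lt_iff₀ hA0] at this
    linarith
  obtain ⟨z, hz, hxz, hz₁⟩ := exists_mem_of_subset_closure hΩ hx.1.le
    (lt_min hx.2 hxA) (min_le_left _ _)
  have hz₁ := hz₁.trans_le (min_le_right _ _)
  refine ⟨y, hy, z, hz, hyx, hxz, ?_⟩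
  have hmain := hf.fst_sub_le hA hB hu hy hz huy (hyx.trans hxz) (by linarith)
  have hyT : (f y).1 ≤ sSup T := le_csSup hTbdd ⟨y, ⟨hy, hyx⟩, rfl⟩
  have : (f y).1 - (f u).1 < ε / B := by linarith
  rw [lt_div_iff₀ hB0] at this
  linarith

lemma MQS.exists_tendsto {n : ℕ} {A B : ℝ} (hA : 1 < A) (hB : 1 < B) {a b : ℝ} {Ω : Set ℝ}
    (hΩ : Ioo a b ⊆ closure Ω) {f : ℝ → ℝ × EuclideanSpace ℝ (Fin n)} (hf : MQS n A B f Ω)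
    {x : ℝ} (hx : x ∈ Ioo a b) : ∃ l, Tendsto f (𝓝[Ω] x) (𝓝 l) := by
  have : (𝓝[Ω] x).NeBot := mem_closure_iff_nhdsWithin_neBot.1 (hΩ hx)
  refine cauchy_map_iff_exists_tendsto.1 (Metric.cauchy_iff.2 ⟨inferInstance, fun ε hε ↦ ?_⟩)
  obtain ⟨y, hy, z, hz, hyx, hxz, hlt⟩ := hf.exists_fst_sub_lt hA hB hΩ hx hε
  refine ⟨f '' (Ω ∩ Ioo y z), image_mem_map
    (inter_mem self_mem_nhdsWithin (mem_nhdsWithin_of_mem_nhds (Ioo_mem_nhds hyx hxz))), ?_⟩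
  rintro _ ⟨s, ⟨hs, hys, hsz⟩, rfl⟩ _ ⟨t, ⟨ht, hyt, htz⟩, rfl⟩
  refine (hf.1.dist_le hs ht).trans_lt (abs_lt.2 ?_)
  have h₁ := hf.1.fst_lt hy hs hys
  have h₂ := hf.1.fst_lt hs hz hsz
  have h₃ := hf.1.fst_lt hy ht hyt
  have h₄ := hf.1.fst_lt ht hz htz
  constructor <;> linarith

/-- Pointwise limits along a dense subset preserve positivity. -/
lemma MPos.of_tendsto {n : ℕ} {a b : ℝ} {Ω : Set ℝ} (hΩ : Ioo a b ⊆ closure Ω)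
    {f g : ℝ → ℝ × EuclideanSpace ℝ (Fin n)} (hf : MPos n f Ω)
    (hg : ∀ x ∈ Ioo a b, Tendsto f (𝓝[Ω] x) (𝓝 (g x))) : MPos n g (Ioo a b) := by
  intro x hx y hy hxy
  have hxne : (𝓝[Ω] x).NeBot := mem_closure_iff_nhdsWithin_neBot.1 (hΩ hx)
  have hyne : (𝓝[Ω] y).NeBot := mem_closure_iff_nhdsWithin_neBot.1 (hΩ hy)
  obtain ⟨s, hs, hxs, hsy⟩ := exists_mem_of_subset_closure hΩ hx.1.le hxy hy.2.le
  obtain ⟨t, ht, hst, hty⟩ := exists_mem_of_subset_closure hΩ (hx.1.trans hxs).le hsy hy.2.le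
  have hclosed : IsClosed {v : ℝ × EuclideanSpace ℝ (Fin n) | ‖v.2‖ ≤ v.1} :=
    isClosed_le (by fun_prop) (by fun_prop)
  have h₁ : f s - g x ∈ {v : ℝ × EuclideanSpace ℝ (Fin n) | ‖v.2‖ ≤ v.1} := by
    refine hclosed.mem_of_tendsto (tendsto_const_nhds.sub (hg x hx)) ?_
    filter_upwards [self_mem_nhdsWithin, mem_nhdsWithin_of_mem_nhds (Iio_mem_nhds hxs)] with u hu hus
    exact le_of_lt (hf u hu s hs hus)
  have h₂ : g y - f t ∈ {v : ℝ × EuclideanSpace ℝ (Fin n) | ‖v.2‖ ≤ v.1} := by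
    refine hclosed.mem_of_tendsto ((hg y hy).sub tendsto_const_nhds) ?_
    filter_upwards [self_mem_nhdsWithin, mem_nhdsWithin_of_mem_nhds (Ioi_mem_nhds hty)] with u hu hut
    exact le_of_lt (hf t ht u hu hut)
  have := MC_add_causal (MC_add_causal (hf s hs t ht hst) h₁) h₂
  convert this using 1
  abel

/-- The quasisymmetry bounds pass to the limit when the ratio lies strictly inside `(A⁻¹, A)`. -/
lemma MQS.ratio_mem_Icc_of_tendsto {n : ℕ} {A B : ℝ} {a b : ℝ} {Ω : Set ℝ}
    (hΩ : Ioo a b ⊆ closure Ω) {f g : ℝ → ℝ × EuclideanSpace ℝ (Fin n)} (hf : MQS n A B f Ω)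
    (hg : ∀ x ∈ Ioo a b, Tendsto f (𝓝[Ω] x) (𝓝 (g x)))
    {x y z : ℝ} (hx : x ∈ Ioo a b) (hy : y ∈ Ioo a b) (hz : z ∈ Ioo a b)
    (hxy : x ≠ y) (hyz : y ≠ z) (hxz : x ≠ z)
    (h : |x - y| / |z - x| ∈ Ioo A⁻¹ A) :
    Mq n (g x - g y) / Mq n (g z - g x) ∈ Icc B⁻¹ B := by
  have hxne : (𝓝[Ω] x).NeBot := mem_closure_iff_nhdsWithin_neBot.1 (hΩ hx)
  have hyne : (𝓝[Ω] y).NeBot := mem_closure_iff_nhdsWithin_neBot.1 (hΩ hy)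
  have hzne : (𝓝[Ω] z).NeBot := mem_closure_iff_nhdsWithin_neBot.1 (hΩ hz)
  let l : Filter (ℝ × ℝ × ℝ) := 𝓝[Ω] x ×ˢ 𝓝[Ω] y ×ˢ 𝓝[Ω] z
  have px : Tendsto (fun p : ℝ × ℝ × ℝ ↦ p.1) l (𝓝[Ω] x) := tendsto_fst
  have py : Tendsto (fun p : ℝ × ℝ × ℝ ↦ p.2.1) l (𝓝[Ω] y) := tendsto_fst.comp tendsto_snd
  have pz : Tendsto (fun p : ℝ × ℝ × ℝ ↦ p.2.2) l (𝓝[Ω] z) := tendsto_snd.comp tendsto_snd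
  have qx := px.mono_right nhdsWithin_le_nhds
  have qy := py.mono_right nhdsWithin_le_nhds
  have qz := pz.mono_right nhdsWithin_le_nhds
  have hne := ((MPos.of_tendsto hΩ hf.1 hg).Mq_sub_pos hz hx hxz.symm).ne'
  have hlim : Tendsto (fun p : ℝ × ℝ × ℝ ↦
      Mq n (f p.1 - f p.2.1) / Mq n (f p.2.2 - f p.1)) l
      (𝓝 (Mq n (g x - g y) / Mq n (g z - g x))) :=
    Tendsto.div
      (((continuous_Mq n).tendsto _).comp (((hg x hx).comp px).sub ((hg y hy).comp py)))
      (((continuous_Mq n).tendsto _).comp (((hg z hz).comp pz).sub ((hg x hx).comp px))) hne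
  have hr : Tendsto (fun p : ℝ × ℝ × ℝ ↦ |p.1 - p.2.1| / |p.2.2 - p.1|) l
      (𝓝 (|x - y| / |z - x|)) :=
    (qx.sub qy).abs.div (qz.sub qx).abs (abs_ne_zero.2 (sub_ne_zero.2 hxz.symm))
  refine isClosed_Icc.mem_of_tendsto hlim ?_
  filter_upwards [px.eventually self_mem_nhdsWithin, py.eventually self_mem_nhdsWithin,
    pz.eventually self_mem_nhdsWithin, hr.eventually (isOpen_Ioo.mem_nhds h),
    (qx.sub qy).eventually_ne (sub_ne_zero.2 hxy), (qy.sub qz).eventually_ne (sub_ne_zero.2 hyz),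
    (qx.sub qz).eventually_ne (sub_ne_zero.2 hxz)]
    with p h₁ h₂ h₃ h₄ h₅ h₆ h₇
  exact hf.2 _ h₁ _ h₂ _ h₃ (sub_ne_zero.1 h₅) (sub_ne_zero.1 h₆)
    (sub_ne_zero.1 h₇) ⟨h₄.1.le, h₄.2.le⟩

/-- Continuous limits along a dense subset preserve quasisymmetry. -/
lemma MQS.of_tendsto {n : ℕ} {A B : ℝ} (hA : 1 < A) {a b : ℝ} {Ω : Set ℝ}
    (hΩ : Ioo a b ⊆ closure Ω) {f g : ℝ → ℝ × EuclideanSpace ℝ (Fin n)} (hf : MQS n A B f Ω)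
    (hg : ∀ x ∈ Ioo a b, Tendsto f (𝓝[Ω] x) (𝓝 (g x))) (hgc : ContinuousOn g (Ioo a b)) :
    MQS n A B g (Ioo a b) := by
  refine ⟨MPos.of_tendsto hΩ hf.1 hg, fun x hx y hy z hz hxy hyz hxz h ↦ ?_⟩
  have hA0 : 0 < A := by linarith
  have hA1 : A⁻¹ < 1 := inv_lt_one_of_one_lt₀ hA
  set r := |x - y| / |z - x|
  have hr : 0 < r := (inv_pos.2 hA0).trans_le h.1
  -- scale `y` about `x` by factors tending to `1` for which the ratio is strictly admissible
  obtain ⟨l, hlne, hl, hmem⟩ : ∃ l : Filter ℝ, l.NeBot ∧ l ≤ 𝓝 1 ∧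
      ∀ᶠ s in l, s * r ∈ Ioo A⁻¹ A := by
    have hc : Tendsto (fun s : ℝ ↦ s * r) (𝓝 1) (𝓝 r) := by
      simpa using (tendsto_id (x := 𝓝 (1 : ℝ))).mul_const r
    rcases le_or_gt r 1 with hr1 | hr1
    · refine ⟨𝓝[>] 1, inferInstance, nhdsWithin_le_nhds, ?_⟩
      filter_upwards [self_mem_nhdsWithin, nhdsWithin_le_nhds
        (hc.eventually (Iio_mem_nhds (hr1.trans_lt hA)))] with s hs hsA
      exact ⟨h.1.trans_lt (lt_mul_of_one_lt_left hr hs), hsA⟩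
    · refine ⟨𝓝[<] 1, inferInstance, nhdsWithin_le_nhds, ?_⟩
      filter_upwards [self_mem_nhdsWithin, nhdsWithin_le_nhds
        (hc.eventually (Ioi_mem_nhds (hA1.trans hr1)))] with s hs hsA
      exact ⟨hsA, (mul_lt_of_lt_one_left hr hs).trans_le h.2⟩
  have hφ : Tendsto (fun s : ℝ ↦ x + s * (y - x)) l (𝓝 y) := by
    have : Tendsto (fun s : ℝ ↦ x + s * (y - x)) (𝓝 1) (𝓝 (x + 1 * (y - x))) :=
      Continuous.tendsto (by fun_prop) 1
    rw [one_mul, add_sub_cancel] at this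
    exact this.mono_left hl
  have hgy : Tendsto (fun s : ℝ ↦ g (x + s * (y - x))) l (𝓝 (g y)) :=
    (hgc.continuousAt (isOpen_Ioo.mem_nhds hy)).tendsto.comp hφ
  have hlim : Tendsto (fun s : ℝ ↦ Mq n (g x - g (x + s * (y - x))) / Mq n (g z - g x)) l
      (𝓝 (Mq n (g x - g y) / Mq n (g z - g x))) :=
    (((continuous_Mq n).tendsto _).comp (tendsto_const_nhds.sub hgy)).div_const _
  refine isClosed_Icc.mem_of_tendsto hlim ?_
  filter_upwards [hmem, hφ.eventually (isOpen_Ioo.mem_nhds hy), hφ.eventually_ne hxy.symm,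
    hφ.eventually_ne hyz, hl (Ioi_mem_nhds zero_lt_one)] with s h₁ h₂ h₃ h₄ h₅
  refine hf.ratio_mem_Icc_of_tendsto hΩ hg hx h₂ hz h₃.symm h₄ hxz ?_
  have : |x - (x + s * (y - x))| = s * |x - y| := by
    rw [sub_add_cancel_left, abs_neg, abs_mul, abs_of_pos h₅, abs_sub_comm]
  rwa [this, mul_div_assoc]

/-- A positive `(A,B)`-quasisymmetric map on a dense subset `Ω` of an open
interval `O = (a,b)` extends uniquely to a continuous map on `O`, and this extension is
positive and `(A,B)`-quasisymmetric on `O`. -/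
theorem stmt_12 (n : ℕ) (A B : ℝ) (hA : 1 < A) (hB : 1 < B) (a b : ℝ) (hab : a < b)
    (Ω : Set ℝ) (hΩ₁ : Ω ⊆ Set.Ioo a b) (hΩ₂ : Set.Ioo a b ⊆ closure Ω)
    (f : ℝ → ℝ × EuclideanSpace ℝ (Fin n)) (hf : MQS n A B f Ω) :
    ∃ g : ℝ → ℝ × EuclideanSpace ℝ (Fin n),
      ContinuousOn g (Set.Ioo a b) ∧ (∀ x ∈ Ω, g x = f x) ∧
      MQS n A B g (Set.Ioo a b) ∧
      ∀ g' : ℝ → ℝ × EuclideanSpace ℝ (Fin n),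
        ContinuousOn g' (Set.Ioo a b) → (∀ x ∈ Ω, g' x = f x) →
        ∀ x ∈ Set.Ioo a b, g' x = g x := by
  have hlim : ∀ x ∈ Ioo a b, ∃ l, Tendsto f (𝓝[Ω] x) (𝓝 l) :=
    fun x hx ↦ hf.exists_tendsto hA hB hΩ₂ hx
  have hg : ∀ x ∈ Ioo a b, Tendsto f (𝓝[Ω] x) (𝓝 (extendFrom Ω f x)) :=
    fun x hx ↦ tendsto_extendFrom (hlim x hx)
  have hgc : ContinuousOn (extendFrom Ω f) (Ioo a b) := continuousOn_extendFrom hΩ₂ hlim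
  refine ⟨extendFrom Ω f, hgc, fun x hx ↦ ?_, hf.of_tendsto hA hΩ₂ hg hgc,
    fun g' hg' hext x hx ↦ ?_⟩
  · exact (tendsto_nhds_unique (tendsto_pure_nhds f x)
      ((hg x (hΩ₁ hx)).mono_left (pure_le_nhdsWithin hx))).symm
  · have : (𝓝[Ω] x).NeBot := mem_closure_iff_nhdsWithin_neBot.1 (hΩ₂ hx)
    refine tendsto_nhds_unique (((hg' x hx).mono_left (nhdsWithin_mono x hΩ₁)).congr' ?_) (hg x hx)
    exact eventually_nhdsWithin_of_forall hext
end

section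
/- Let K > 1, let b = (−1, 0) and c = (1, 0) in F, let Δ = {w ∈ F | w − b ∈ C and c − w ∈ C} be the diamond with vertices b and c, and let C_K = {w ∈ Δ | K⁻¹ ≤ q(c − w)/q(w − b) ≤ K}. If p, p′ ∈ C_K satisfy q(p′ − p) = 0, then the Euclidean norm of p′ − p satisfies √((p′ − p)₁² + ‖(p′ − p)′‖²) ≤ √2·(K − 1)/(K + 1). (This is the key claim of the paper's Contraction Lemma: every lightlike segment contained in C_K has Euclidean length at most √2·(K−1)/(K+1), while lightlike chords of the full diamond have length √2.) -/
/-- An affine cross-ratio estimate: `α` and `β` bound the distances from a segment of length `2t`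
to the ends of a segment of length `2`, and the ratio of end values is controlled by `K`. -/
theorem length_le_of_ratio_bounds {K a d t α β : ℝ} (hK : 1 < K) (ha : 0 < a) (hd : 0 < d)
    (ht : 0 ≤ t) (hα : 0 < α) (hβ : 0 < β) (hsum : α + β ≤ 2 - 2 * t)
    (h₁ : d * (β + 2 * t) ≤ K * (a * α)) (h₂ : a * (α + 2 * t) ≤ K * (d * β)) :
    t ≤ (K - 1) / (K + 1) := by
  have hprod : (β + 2 * t) * (α + 2 * t) ≤ K ^ 2 * (α * β) := by
    have h := mul_le_mul h₁ h₂ (by positivity) (by positivity)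
    refine le_of_mul_le_mul_left ?_ (mul_pos ha hd)
    linarith
  have hsq : ((α + β) / 2 + 2 * t) ^ 2 ≤ (K * ((α + β) / 2)) ^ 2 := by
    have hK2 : 0 ≤ K ^ 2 - 1 := by nlinarith
    nlinarith [mul_nonneg hK2 (sq_nonneg (α - β))]
  have hlin := (sq_le_sq₀ (by positivity) (by positivity)).1 hsq
  rw [le_div_iff₀ (by linarith)]
  nlinarith [mul_le_mul_of_nonneg_left hsum (by linarith : 0 ≤ K - 1)]

/-- A future-directed lightlike chord of `C_K` has time extent at most `(K - 1) / (K + 1)`. -/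
theorem lightlike_time_le {E : Type*} [NormedAddCommGroup E] [InnerProductSpace ℝ E]
    {K x x' : ℝ} {u u' : E} (hK : 1 < K)
    (hb : ‖u‖ < x + 1) (hc : ‖u‖ < 1 - x) (hc' : ‖u'‖ < 1 - x')
    (h₁ : (1 - x) ^ 2 - ‖u‖ ^ 2 ≤ K * ((x + 1) ^ 2 - ‖u‖ ^ 2))
    (h₂ : (x' + 1) ^ 2 - ‖u'‖ ^ 2 ≤ K * ((1 - x') ^ 2 - ‖u'‖ ^ 2))
    (hle : x ≤ x') (hlight : (x' - x) ^ 2 = ‖u' - u‖ ^ 2) :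
    x' - x ≤ (K - 1) / (K + 1) := by
  rcases hle.eq_or_lt with rfl | hlt
  · rw [sub_self]
    exact div_nonneg (by linarith) (by linarith)
  obtain ⟨t, rfl⟩ : ∃ t, x' = x + t := ⟨x' - x, by ring⟩
  have ht : 0 < t := by linarith
  rw [add_sub_cancel_left] at hlight ⊢
  have hnorm : ‖u' - u‖ = t := ((sq_eq_sq₀ ht.le (norm_nonneg _)).1 hlight).symm
  obtain ⟨y, hy⟩ : ∃ y, inner ℝ u (u' - u) = t * y :=
    ⟨inner ℝ u (u' - u) / t, by field_simp⟩
  have hu' : ‖u'‖ ^ 2 = ‖u‖ ^ 2 + 2 * (t * y) + t ^ 2 := by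
    have h := norm_add_sq_real u (u' - u)
    rwa [add_sub_cancel, hy, hnorm] at h
  have hyu : |y| ≤ ‖u‖ := by
    have h := abs_real_inner_le_norm u (u' - u)
    rw [hy, hnorm, abs_mul, abs_of_pos ht, mul_comm] at h
    exact le_of_mul_le_mul_right h ht
  have hy2 : y ^ 2 ≤ ‖u‖ ^ 2 := sq_le_sq.2 (by rwa [abs_norm])
  obtain ⟨hy₁, hy₂⟩ := abs_le.1 hyu
  have ha : 0 < x + 1 - y := by linarith
  have hd : 0 < 1 - x + y := by linarith
  have hA : 0 < (x + 1) ^ 2 - ‖u‖ ^ 2 := by nlinarith [norm_nonneg u]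
  have hB : 0 < (1 - (x + t)) ^ 2 - ‖u'‖ ^ 2 := by nlinarith [norm_nonneg u']
  obtain ⟨α, hα⟩ : ∃ α, (x + 1) ^ 2 - ‖u‖ ^ 2 = (x + 1 - y) * α :=
    ⟨((x + 1) ^ 2 - ‖u‖ ^ 2) / (x + 1 - y), by field_simp⟩
  obtain ⟨β, hβ⟩ : ∃ β, (1 - (x + t)) ^ 2 - ‖u'‖ ^ 2 = (1 - x + y) * β :=
    ⟨((1 - (x + t)) ^ 2 - ‖u'‖ ^ 2) / (1 - x + y), by field_simp⟩
  have hα₀ : 0 < α := pos_of_mul_pos_right (hα ▸ hA) ha.le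
  have hβ₀ : 0 < β := pos_of_mul_pos_right (hβ ▸ hB) hd.le
  have hα₁ : α ≤ x + 1 + y := le_of_mul_le_mul_left (by linarith) ha
  have hβ₁ : β ≤ 1 - x - y - 2 * t := le_of_mul_le_mul_left (by linarith) hd
  refine length_le_of_ratio_bounds hK ha hd ht.le hα₀ hβ₀ (by linarith) ?_ ?_
  · rw [← hα]
    linarith
  · rw [← hβ]
    linarith

/-- key claim of the Contraction Lemma: with `b = (−1,0)`, `c = (1,0)`,
`Δ = {w | w − b ∈ C, c − w ∈ C}` and `C_K = {w ∈ Δ | K⁻¹ ≤ q(c−w)/q(w−b) ≤ K}`, any two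
points `p, p′ ∈ C_K` with `q(p′ − p) = 0` satisfy
`√((p′−p)₁² + ‖(p′−p)′‖²) ≤ √2·(K−1)/(K+1)`: a lightlike segment in `C_K` has Euclidean
length at most `√2·(K−1)/(K+1)`. -/
theorem stmt_14 (n : ℕ) (K : ℝ) (hK : 1 < K)
    (b c : ℝ × EuclideanSpace ℝ (Fin n)) (hb : b = (-1, 0)) (hc : c = (1, 0))
    (p p' : ℝ × EuclideanSpace ℝ (Fin n))
    (hpΔ : p - b ∈ MC n ∧ c - p ∈ MC n)
    (hpK : K⁻¹ ≤ Mq n (c - p) / Mq n (p - b) ∧ Mq n (c - p) / Mq n (p - b) ≤ K)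
    (hp'Δ : p' - b ∈ MC n ∧ c - p' ∈ MC n)
    (hp'K : K⁻¹ ≤ Mq n (c - p') / Mq n (p' - b) ∧ Mq n (c - p') / Mq n (p' - b) ≤ K)
    (hlight : Mq n (p' - p) = 0) :
    Real.sqrt ((p' - p).1 ^ 2 + ‖(p' - p).2‖ ^ 2) ≤
      Real.sqrt 2 * (K - 1) / (K + 1) := by
  subst hb hc
  obtain ⟨x, u⟩ := p
  obtain ⟨x', u'⟩ := p'
  simp only [MC, Mq, Set.mem_ofPred_eq, Prod.mk_sub_mk, sub_neg_eq_add, sub_zero, zero_sub,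
    norm_neg] at *
  obtain ⟨hb, hc⟩ := hpΔ
  obtain ⟨hb', hc'⟩ := hp'Δ
  have hK₀ : 0 < K := by linarith
  have hA : 0 < (x + 1) ^ 2 - ‖u‖ ^ 2 := by nlinarith [norm_nonneg u]
  have hA' : 0 < (x' + 1) ^ 2 - ‖u'‖ ^ 2 := by nlinarith [norm_nonneg u']
  have h₁ := (div_le_iff₀ hA).1 hpK.2
  have h₁' := (div_le_iff₀ hA').1 hp'K.2
  have h₂ := (inv_mul_le_iff₀ hK₀).1 ((le_div_iff₀ hA).1 hpK.1)
  have h₂' := (inv_mul_le_iff₀ hK₀).1 ((le_div_iff₀ hA').1 hp'K.1)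
  have habs : |x' - x| ≤ (K - 1) / (K + 1) := by
    rcases le_total x x' with hle | hle
    · rw [abs_of_nonneg (sub_nonneg.2 hle)]
      exact lightlike_time_le hK hb hc hc' h₁ h₂' hle (by linarith)
    · rw [abs_of_nonpos (sub_nonpos.2 hle), neg_sub]
      exact lightlike_time_le hK hb' hc' hc h₁' h₂ hle (by rw [norm_sub_rev]; linarith)
  have hsum : (x' - x) ^ 2 + ‖u' - u‖ ^ 2 = 2 * (x' - x) ^ 2 := by linarith
  rw [hsum, Real.sqrt_mul zero_le_two, Real.sqrt_sq_eq_abs, mul_div_assoc]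
  exact mul_le_mul_of_nonneg_left habs (Real.sqrt_nonneg 2)
end

section
/- For all s, t ∈ ℝ one has ⟨γ(s), γ(t)⟩ = −(cosh(λ(t − s)) + cosh(μ(t − s)))/2. In particular q(γ(t)) = −1 for every t, so the whole orbit γ(ℝ) (and more generally the orbit of z₀+z₁+z₂+z₃ under the diagonal flow, i.e. the Barbot surface) lies in the quadric {x ∈ E | q(x) = −1} defining the pseudo-hyperbolic space H^{2,n}. -/
/-- For the Barbot geodesic
`γ(t) = e^{λt}z₀ + e^{μt}z₁ + e^{−λt}z₂ + e^{−μt}z₃` one has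
`⟨γ(s), γ(t)⟩ = −(cosh(λ(t−s)) + cosh(μ(t−s)))/2`; in particular `q(γ(t)) = −1`, so the
orbit lies in the quadric `{q = −1}` defining the pseudo-hyperbolic space `H^{2,n}`. -/
theorem stmt_15 (E : Type*) [AddCommGroup E] [Module ℝ E]
    (B : E →ₗ[ℝ] E →ₗ[ℝ] ℝ) (hsymm : ∀ x y, B x y = B y x)
    (z₀ z₁ z₂ z₃ : E)
    (hq₀ : B z₀ z₀ = 0) (hq₁ : B z₁ z₁ = 0) (hq₂ : B z₂ z₂ = 0) (hq₃ : B z₃ z₃ = 0)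
    (h₀₁ : B z₀ z₁ = 0) (h₁₂ : B z₁ z₂ = 0) (h₂₃ : B z₂ z₃ = 0) (h₃₀ : B z₃ z₀ = 0)
    (h₀₂ : B z₀ z₂ = -(1 / 4)) (h₁₃ : B z₁ z₃ = -(1 / 4))
    (l m : ℝ) (γ : ℝ → E)
    (hγ : ∀ t, γ t = Real.exp (l * t) • z₀ + Real.exp (m * t) • z₁ +
      Real.exp (-(l * t)) • z₂ + Real.exp (-(m * t)) • z₃) :
    (∀ s t : ℝ, B (γ s) (γ t) =
      -((Real.cosh (l * (t - s)) + Real.cosh (m * (t - s))) / 2)) ∧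
    (∀ t : ℝ, B (γ t) (γ t) = -1) := by
  have pairing : ∀ s t : ℝ, B (γ s) (γ t) =
      -((Real.cosh (l * (t - s)) + Real.cosh (m * (t - s))) / 2) := by
    intro s t
    have h₁₀ : B z₁ z₀ = 0 := hsymm z₁ z₀ ▸ h₀₁
    have h₂₁ : B z₂ z₁ = 0 := hsymm z₂ z₁ ▸ h₁₂
    have h₃₂ : B z₃ z₂ = 0 := hsymm z₃ z₂ ▸ h₂₃
    have h₀₃ : B z₀ z₃ = 0 := hsymm z₀ z₃ ▸ h₃₀
    have h₂₀ : B z₂ z₀ = -(1 / 4) := hsymm z₂ z₀ ▸ h₀₂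
    have h₃₁ : B z₃ z₁ = -(1 / 4) := hsymm z₃ z₁ ▸ h₁₃
    have cosh_eq (a : ℝ) : Real.cosh (a * (t - s)) =
        (Real.exp (a * t) * Real.exp (-(a * s)) + Real.exp (-(a * t)) * Real.exp (a * s)) / 2 := by
      rw [Real.cosh_eq, ← Real.exp_add, ← Real.exp_add]
      ring_nf
    simp only [hγ, map_add, map_smul, LinearMap.add_apply, LinearMap.smul_apply, smul_eq_mul,
      hq₀, hq₁, hq₂, hq₃, h₀₁, h₁₂, h₂₃, h₃₀, h₀₂, h₁₃, h₁₀, h₂₁, h₃₂, h₀₃, h₂₀, h₃₁, cosh_eq]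
    ring
  refine ⟨pairing, fun t => ?_⟩
  rw [pairing]
  norm_num
end

section
/- (a) For all real λ, μ, t: cosh(λt) + cosh(μt) ≤ 2·cosh(t·√(λ² + μ²)) = 2·cosh(√2·|t|·√((λ² + μ²)/2)). (b) The constant √2 is optimal: for every real c with 0 ≤ c < √2 there exist λ, μ, not both zero, and t > 0 such that cosh(λt) + cosh(μt) > 2·cosh(c·t·√((λ² + μ²)/2)). -/
/-- If `0 ≤ a < 1`, then `cosh t` eventually dominates `2 * cosh (a * t)`. -/
theorem exists_pos_two_mul_cosh_mul_le_cosh {a : ℝ} (ha : 0 ≤ a) (ha1 : a < 1) :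
    ∃ t : ℝ, 0 < t ∧ 2 * Real.cosh (a * t) ≤ Real.cosh t := by
  have h1 : 0 < 1 - a := sub_pos.mpr ha1
  have ht : 0 < 3 / (1 - a) := by positivity
  refine ⟨3 / (1 - a), ht, ?_⟩
  set t := 3 / (1 - a) with htdef
  have hsum : t = a * t + 3 := by
    rw [htdef]
    field_simp
    ring
  have hexp : Real.exp t = Real.exp (a * t) * Real.exp 3 := by
    rw [← Real.exp_add, ← hsum]
  have h3 : (4 : ℝ) ≤ Real.exp 3 := by
    linarith [Real.add_one_le_exp (3 : ℝ)]
  have hneg : Real.exp (-(a * t)) ≤ Real.exp (a * t) :=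
    Real.exp_le_exp.mpr (by linarith [mul_nonneg ha ht.le])
  have hmul : Real.exp (a * t) * 4 ≤ Real.exp t := by
    rw [hexp]
    gcongr
  rw [Real.cosh_eq, Real.cosh_eq]
  linarith [Real.exp_pos (-t)]

/-- `cosh (x * t)` is at most `cosh (t * r)` when `x ^ 2 ≤ r ^ 2`. -/
theorem cosh_mul_le_cosh_mul_of_sq_le {x r : ℝ} (t : ℝ) (h : x ^ 2 ≤ r ^ 2) :
    Real.cosh (x * t) ≤ Real.cosh (t * r) := by
  rw [Real.cosh_le_cosh, mul_comm, abs_mul, abs_mul]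
  exact mul_le_mul_of_nonneg_left (sq_le_sq.mp h) (abs_nonneg t)

/-- (a) For all real `λ, μ, t`:
`cosh(λt) + cosh(μt) ≤ 2·cosh(t·√(λ²+μ²)) = 2·cosh(√2·|t|·√((λ²+μ²)/2))`.
(b) The constant `√2` is optimal: for every `0 ≤ c < √2` there exist `λ, μ` not both zero
and `t > 0` with `cosh(λt) + cosh(μt) > 2·cosh(c·t·√((λ²+μ²)/2))`. -/
theorem stmt_16 :
    (∀ l m t : ℝ,
      Real.cosh (l * t) + Real.cosh (m * t) ≤
        2 * Real.cosh (t * Real.sqrt (l ^ 2 + m ^ 2)) ∧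
      2 * Real.cosh (t * Real.sqrt (l ^ 2 + m ^ 2)) =
        2 * Real.cosh (Real.sqrt 2 * |t| * Real.sqrt ((l ^ 2 + m ^ 2) / 2))) ∧
    (∀ c : ℝ, 0 ≤ c → c < Real.sqrt 2 →
      ∃ l m t : ℝ, (l ≠ 0 ∨ m ≠ 0) ∧ 0 < t ∧
        2 * Real.cosh (c * t * Real.sqrt ((l ^ 2 + m ^ 2) / 2)) <
          Real.cosh (l * t) + Real.cosh (m * t)) := by
  refine ⟨fun l m t => ⟨?_, ?_⟩, fun c hc hc2 => ?_⟩
  · have hr : Real.sqrt (l ^ 2 + m ^ 2) ^ 2 = l ^ 2 + m ^ 2 := Real.sq_sqrt (by positivity)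
    have hl := cosh_mul_le_cosh_mul_of_sq_le (x := l) (r := Real.sqrt (l ^ 2 + m ^ 2)) t
      (by linarith [sq_nonneg m])
    have hm := cosh_mul_le_cosh_mul_of_sq_le (x := m) (r := Real.sqrt (l ^ 2 + m ^ 2)) t
      (by linarith [sq_nonneg l])
    linarith
  · have hr : Real.sqrt 2 * |t| * Real.sqrt ((l ^ 2 + m ^ 2) / 2) =
        |t * Real.sqrt (l ^ 2 + m ^ 2)| := by
      rw [mul_right_comm, ← Real.sqrt_mul zero_le_two, mul_div_cancel₀ _ two_ne_zero, abs_mul,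
        abs_of_nonneg (Real.sqrt_nonneg _), mul_comm]
    rw [hr, Real.cosh_abs]
  · have ha1 : c * Real.sqrt (1 / 2) < 1 := by
      rw [Real.sqrt_div zero_le_one, Real.sqrt_one, mul_one_div, div_lt_one (by positivity)]
      exact hc2
    obtain ⟨t, ht, h⟩ := exists_pos_two_mul_cosh_mul_le_cosh (by positivity) ha1
    refine ⟨1, 0, t, Or.inl one_ne_zero, ht, ?_⟩
    have harg : c * t * Real.sqrt (((1 : ℝ) ^ 2 + 0 ^ 2) / 2) = c * Real.sqrt (1 / 2) * t := by
      norm_num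
      ring
    rw [harg, one_mul, zero_mul, Real.cosh_zero]
    linarith
end
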